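/- (Young–Love estimate) Let x : [a,b] → M_d (d×d matrices) be càdlàg with finite q-variation and z : [a,b] → ℝᵈ càdlàg with finite p-variation, where p, q ≥ 1 and 1/p + 1/q > 1. Then the Riemann–Stieltjes integral ∫_a^· x_{s−} dz_s exists as a càdlàg function and V_p(∫_a^· x_{s−} dz_s)_{[a,b]} ≤ C_{p,q} · V̄_q(x)_{[a,b)} · V_p(z)_{[a,b]}, where C_{p,q} = ζ(1/p + 1/q) and ζ is the Riemann zeta function. -/

import Mathlib

open Set Filter Function MeasureTheory

noncomputable section

abbrev Eu (d : ℕ) := EuclideanSpace ℝ (Fin d)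

def varSums {E : Type*} [NormedAddCommGroup E] (p : ℝ) (x : ℝ → E) (a b : ℝ) : Set ℝ :=
  {v | ∃ (n : ℕ) (t : Fin (n + 1) → ℝ), Monotone t ∧ t 0 = a ∧ t (Fin.last n) = b ∧
    v = ∑ i : Fin n, ‖x (t i.succ) - x (t i.castSucc)‖ ^ p}

/-- p-variation `v_p(x)_{[a,b]}` (supremum over partitions of `[a,b]`). -/
def vpvar {E : Type*} [NormedAddCommGroup E] (p : ℝ) (x : ℝ → E) (a b : ℝ) : ℝ :=
  sSup (varSums p x a b)

/-- `x` has finite p-variation on `[a,b]`. -/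
def HasFinVar {E : Type*} [NormedAddCommGroup E] (p : ℝ) (x : ℝ → E) (a b : ℝ) : Prop :=
  BddAbove (varSums p x a b)

/-- `V_p(x)_{[a,b]} = (v_p(x)_{[a,b]})^{1/p}`. -/
def Vp {E : Type*} [NormedAddCommGroup E] (p : ℝ) (x : ℝ → E) (a b : ℝ) : ℝ :=
  vpvar p x a b ^ (1 / p)

/-- p-variation norm `V̄_p(x)_{[a,b]} = V_p(x)_{[a,b]} + ‖x a‖`. -/
def VpNorm {E : Type*} [NormedAddCommGroup E] (p : ℝ) (x : ℝ → E) (a b : ℝ) : ℝ :=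
  Vp p x a b + ‖x a‖

/-- càdlàg : right-continuous with left limits. -/
def Cadlag {E : Type*} [NormedAddCommGroup E] (x : ℝ → E) : Prop :=
  (∀ t : ℝ, ContinuousWithinAt x (Ici t) t) ∧
  ∀ t : ℝ, ∃ c : E, Tendsto x (nhdsWithin t (Iio t)) (nhds c)
/-- `I` is the Riemann–Stieltjes integral `∫_a^b B(x_s, dz_s)` : limit of left-point
Riemann–Stieltjes sums as the mesh of the partition tends to `0`. -/
def IsRSInt {M Z F : Type*} [NormedAddCommGroup M] [NormedAddCommGroup Z]
    [NormedAddCommGroup F] (B : M → Z → F) (x : ℝ → M) (z : ℝ → Z)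
    (a b : ℝ) (I : F) : Prop :=
  ∀ ε : ℝ, 0 < ε → ∃ δ : ℝ, 0 < δ ∧ ∀ (n : ℕ) (t : Fin (n + 1) → ℝ),
    Monotone t → t 0 = a → t (Fin.last n) = b →
    (∀ i : Fin n, t i.succ - t i.castSucc ≤ δ) →
    ‖(∑ i : Fin n, B (x (t i.castSucc)) (z (t i.succ) - z (t i.castSucc))) - I‖ < ε
/-- p-variation `v_p(x)_{[a,b)}` over the half-open interval. -/
def vpvarIco {E : Type*} [NormedAddCommGroup E] (p : ℝ) (x : ℝ → E) (a b : ℝ) : ℝ :=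
  sSup {v | ∃ (n : ℕ) (t : Fin (n + 1) → ℝ), Monotone t ∧ t 0 = a ∧ t (Fin.last n) < b ∧
    v = ∑ i : Fin n, ‖x (t i.succ) - x (t i.castSucc)‖ ^ p}

/-! ### Bounds on the `p`-variation along monotone sequences -/

/-- The `p`-variation sums of `x` along monotone sequences in `T` are at most `C`. -/
def VarBound {E : Type*} [NormedAddCommGroup E] (p : ℝ) (x : ℝ → E) (T : Set ℝ) (C : ℝ) : Prop :=
  ∀ (n : ℕ) (φ : ℕ → ℝ), Monotone φ → (∀ i ≤ n, φ i ∈ T) →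
    ∑ i ∈ Finset.range n, ‖x (φ (i + 1)) - x (φ i)‖ ^ p ≤ C

/-- Left-point Riemann–Stieltjes sum along the first `n` steps of `φ`. -/
def rsSum {E F : Type*} [NormedAddCommGroup E] [NormedSpace ℝ E] [NormedAddCommGroup F]
    [NormedSpace ℝ F] (x : ℝ → E →L[ℝ] F) (z : ℝ → E) (φ : ℕ → ℝ) (n : ℕ) : F :=
  ∑ i ∈ Finset.range n, x (φ i) (z (φ (i + 1)) - z (φ i))

section Variation

variable {E : Type*} [NormedAddCommGroup E] {p q : ℝ} {x y : ℝ → E} {S T : Set ℝ} {C C' : ℝ}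

theorem mem_varSums_of_seq {a b : ℝ} {n : ℕ} {φ : ℕ → ℝ} (hφ : Monotone φ) (h0 : φ 0 = a)
    (hn : φ n = b) :
    ∑ i ∈ Finset.range n, ‖x (φ (i + 1)) - x (φ i)‖ ^ p ∈ varSums p x a b := by
  refine ⟨n, fun i => φ i, fun i j hij => hφ hij, by simpa using h0, by simpa using hn, ?_⟩
  simp [Finset.sum_range]

theorem exists_seq_of_fin {n : ℕ} {t : Fin (n + 1) → ℝ} (ht : Monotone t) :
    ∃ φ : ℕ → ℝ, Monotone φ ∧ φ 0 = t 0 ∧ φ n = t (Fin.last n) ∧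
      (∀ i : Fin n, φ i = t i.castSucc) ∧ ∀ i : Fin n, φ (i + 1) = t i.succ := by
  refine ⟨fun i => t ⟨min i n, by omega⟩, fun i j hij => ht ?_, by simp, by simp; rfl,
    fun i => ?_, fun i => ?_⟩
  · simp only [Fin.mk_le_mk]
    omega
  · exact congrArg t (Fin.ext (by simp [i.2.le]))
  · exact congrArg t (Fin.ext (by simp [Nat.succ_le_of_lt i.2]))

theorem exists_seq_of_mem_varSums {a b v : ℝ} (h : v ∈ varSums p x a b) :
    ∃ (n : ℕ) (φ : ℕ → ℝ), Monotone φ ∧ φ 0 = a ∧ φ n = b ∧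
      v = ∑ i ∈ Finset.range n, ‖x (φ (i + 1)) - x (φ i)‖ ^ p := by
  obtain ⟨n, t, ht, h0, hn, rfl⟩ := h
  obtain ⟨φ, hφ, h0', hn', hc, hs⟩ := exists_seq_of_fin ht
  refine ⟨n, φ, hφ, h0'.trans h0, hn'.trans hn, ?_⟩
  simp [Finset.sum_range, hc, hs]

theorem nonneg_of_mem_varSums {a b v : ℝ} (h : v ∈ varSums p x a b) : 0 ≤ v := by
  obtain ⟨n, t, -, -, -, rfl⟩ := h
  positivity

theorem vpvar_nonneg {a b : ℝ} : 0 ≤ vpvar p x a b :=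
  Real.sSup_nonneg fun _ => nonneg_of_mem_varSums

theorem varSums_nonempty {a b : ℝ} (hab : a ≤ b) : (varSums p x a b).Nonempty := by
  refine ⟨_, mem_varSums_of_seq (n := 1) (φ := fun i => if i = 0 then a else b) ?_ ?_ ?_⟩
  · intro i j hij
    dsimp only
    split_ifs <;> first | omega | exact le_rfl
  · simp
  · simp

/-- Concatenation of two variation sums. -/
theorem add_mem_varSums {a b c v w : ℝ} (hv : v ∈ varSums p x a b) (hw : w ∈ varSums p x b c) :
    v + w ∈ varSums p x a c := by
  obtain ⟨n, φ, hφ, h0, hn, rfl⟩ := exists_seq_of_mem_varSums hv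
  obtain ⟨m, ψ, hψ, g0, gm, rfl⟩ := exists_seq_of_mem_varSums hw
  let χ : ℕ → ℝ := fun i => if i ≤ n then φ i else ψ (i - n)
  have hχ1 : ∀ i ≤ n, χ i = φ i := fun i hi => by simp [χ, hi]
  have hχ2 : ∀ i, χ (n + i) = ψ i := by
    intro i
    rcases Nat.eq_zero_or_pos i with rfl | hi
    · simp [χ, hn, g0]
    · simp [χ, hi.ne']
  have hmono : Monotone χ := by
    intro i j hij
    rcases le_total j n with hj | hj
    · rw [hχ1 _ hj, hχ1 _ (hij.trans hj)]
      exact hφ hij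
    · obtain ⟨j, rfl⟩ := Nat.exists_eq_add_of_le hj
      rw [hχ2]
      rcases le_total i n with hi | hi
      · rw [hχ1 _ hi]
        calc φ i ≤ φ n := hφ hi
          _ = ψ 0 := by rw [hn, g0]
          _ ≤ ψ j := hψ (Nat.zero_le _)
      · obtain ⟨i, rfl⟩ := Nat.exists_eq_add_of_le hi
        rw [hχ2]
        exact hψ (by omega)
  have hmem := mem_varSums_of_seq (p := p) (x := x) (n := n + m) hmono
    ((hχ1 0 (Nat.zero_le _)).trans h0) ((hχ2 m).trans gm)
  rw [Finset.sum_range_add] at hmem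
  convert hmem using 2
  · refine Finset.sum_congr rfl fun i hi => ?_
    have := Finset.mem_range.1 hi
    rw [hχ1 i this.le, hχ1 (i + 1) this]
  · refine Finset.sum_congr rfl fun i _ => ?_
    rw [hχ2 i, add_assoc, hχ2 (i + 1)]

theorem HasFinVar.mono {a b s t : ℝ} (h : HasFinVar p x a b) (has : a ≤ s) (htb : t ≤ b) :
    HasFinVar p x s t := by
  obtain ⟨C, hC⟩ := h
  refine ⟨C, fun v hv => ?_⟩
  obtain ⟨u, hu⟩ := varSums_nonempty (p := p) (x := x) has
  obtain ⟨w, hw⟩ := varSums_nonempty (p := p) (x := x) htb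
  have := hC (add_mem_varSums (add_mem_varSums hu hv) hw)
  linarith [nonneg_of_mem_varSums hu, nonneg_of_mem_varSums hw]

/-- Superadditivity of the `p`-variation. -/
theorem vpvar_add_le {a b c : ℝ} (hab : a ≤ b) (hbc : b ≤ c) (h : HasFinVar p x a c) :
    vpvar p x a b + vpvar p x b c ≤ vpvar p x a c := by
  rw [← le_sub_iff_add_le]
  refine csSup_le (varSums_nonempty hab) fun v hv => ?_
  rw [le_sub_comm]
  refine csSup_le (varSums_nonempty hbc) fun w hw => ?_
  rw [le_sub_iff_add_le, add_comm]
  exact le_csSup h (add_mem_varSums hv hw)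

theorem sum_vpvar_le {a b : ℝ} (h : HasFinVar p x a b) {φ : ℕ → ℝ} (hφ : Monotone φ)
    (h0 : φ 0 = a) (n : ℕ) (hn : φ n ≤ b) :
    ∑ i ∈ Finset.range n, vpvar p x (φ i) (φ (i + 1)) ≤ vpvar p x a (φ n) := by
  induction n with
  | zero => simpa using vpvar_nonneg
  | succ n ih =>
    rw [Finset.sum_range_succ]
    have hle := hφ n.le_succ
    refine (add_le_add_left (ih (hle.trans hn)) _).trans ?_
    exact vpvar_add_le (h0 ▸ hφ n.zero_le) hle (h.mono le_rfl hn)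

theorem HasFinVar.varBound {a b : ℝ} (h : HasFinVar p x a b) :
    VarBound p x (Icc a b) (vpvar p x a b) := by
  intro n φ hφ hT
  have h0 := hT 0 n.zero_le
  have hn := hT n le_rfl
  obtain ⟨u, hu⟩ := varSums_nonempty (p := p) (x := x) h0.1
  obtain ⟨w, hw⟩ := varSums_nonempty (p := p) (x := x) hn.2
  have := le_csSup h (add_mem_varSums (add_mem_varSums hu (mem_varSums_of_seq hφ rfl rfl)) hw)
  rw [vpvar]
  linarith [nonneg_of_mem_varSums hu, nonneg_of_mem_varSums hw]

theorem vpvarIco_nonneg {a b : ℝ} : 0 ≤ vpvarIco p x a b := by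
  refine Real.sSup_nonneg ?_
  rintro _ ⟨n, t, -, -, -, rfl⟩
  positivity

theorem HasFinVar.varBound_Ico {a b : ℝ} (h : HasFinVar p x a b) :
    VarBound p x (Ico a b) (vpvarIco p x a b) := by
  intro n φ hφ hT
  have hn := hT n le_rfl
  have hbdd : BddAbove {v | ∃ (n : ℕ) (t : Fin (n + 1) → ℝ), Monotone t ∧ t 0 = a ∧
      t (Fin.last n) < b ∧ v = ∑ i : Fin n, ‖x (t i.succ) - x (t i.castSucc)‖ ^ p} := by
    obtain ⟨C, hC⟩ := h
    refine ⟨C, ?_⟩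
    rintro v ⟨m, t, ht, ht0, htm, rfl⟩
    obtain ⟨w, hw⟩ := varSums_nonempty (p := p) (x := x) htm.le
    have := hC (add_mem_varSums ⟨m, t, ht, ht0, rfl, rfl⟩ hw)
    linarith [nonneg_of_mem_varSums hw]
  obtain ⟨u, hu⟩ := varSums_nonempty (p := p) (x := x) (hT 0 n.zero_le).1
  obtain ⟨m, t, ht, ht0, htm, he⟩ := add_mem_varSums hu (mem_varSums_of_seq (n := n) hφ rfl rfl)
  have := le_csSup hbdd ⟨m, t, ht, ht0, htm.trans_lt hn.2, he⟩
  rw [vpvarIco]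
  linarith [nonneg_of_mem_varSums hu]

theorem VarBound.comp {g : ℝ → ℝ} (h : VarBound p x T C) (hg : Monotone g) (hST : MapsTo g S T) :
    VarBound p (fun u => x (g u)) S C :=
  fun n φ hφ hS => h n (fun i => g (φ i)) (hg.comp hφ) fun i hi => hST (hS i hi)

theorem Real.add_rpow_le_two_rpow_mul {u v : ℝ} (hu : 0 ≤ u) (hv : 0 ≤ v) (hq : 0 ≤ q) :
    (u + v) ^ q ≤ 2 ^ q * (u ^ q + v ^ q) := by
  have hu' := Real.rpow_nonneg hu q
  have hv' := Real.rpow_nonneg hv q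
  rcases le_total u v with h | h
  · calc (u + v) ^ q ≤ (2 * v) ^ q := Real.rpow_le_rpow (by positivity) (by linarith) hq
      _ = 2 ^ q * v ^ q := Real.mul_rpow (by norm_num) hv
      _ ≤ _ := by gcongr; linarith
  · calc (u + v) ^ q ≤ (2 * u) ^ q := Real.rpow_le_rpow (by positivity) (by linarith) hq
      _ = 2 ^ q * u ^ q := Real.mul_rpow (by norm_num) hu
      _ ≤ _ := by gcongr; linarith

theorem VarBound.sub (hq : 0 ≤ q) (hx : VarBound q x T C) (hy : VarBound q y T C') :
    VarBound q (fun u => x u - y u) T (2 ^ q * (C + C')) := by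
  intro n φ hφ hT
  calc ∑ i ∈ Finset.range n, ‖x (φ (i + 1)) - y (φ (i + 1)) - (x (φ i) - y (φ i))‖ ^ q
      ≤ ∑ i ∈ Finset.range n, 2 ^ q *
          (‖x (φ (i + 1)) - x (φ i)‖ ^ q + ‖y (φ (i + 1)) - y (φ i)‖ ^ q) := by
        refine Finset.sum_le_sum fun i _ => ?_
        refine le_trans (Real.rpow_le_rpow (norm_nonneg _) ?_ hq)
          (Real.add_rpow_le_two_rpow_mul (norm_nonneg _) (norm_nonneg _) hq)
        rw [sub_sub_sub_comm]
        exact norm_sub_le _ _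
    _ ≤ 2 ^ q * (C + C') := by
        rw [← Finset.mul_sum, Finset.sum_add_distrib]
        gcongr
        · exact hx n φ hφ hT
        · exact hy n φ hφ hT

/-- Interpolation between the `q`-variation and the supremum norm. -/
theorem VarBound.of_exponent_lt {r ε : ℝ} (hq : 0 < q) (hqr : q < r) (h : VarBound q x T C)
    (hε : ∀ u ∈ T, ‖x u‖ ≤ ε) : VarBound r x T ((2 * ε) ^ (r - q) * C) := by
  intro n φ hφ hT
  have hε0 : 0 ≤ ε := (norm_nonneg _).trans (hε _ (hT 0 n.zero_le))
  calc ∑ i ∈ Finset.range n, ‖x (φ (i + 1)) - x (φ i)‖ ^ r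
      ≤ ∑ i ∈ Finset.range n, (2 * ε) ^ (r - q) * ‖x (φ (i + 1)) - x (φ i)‖ ^ q := by
        refine Finset.sum_le_sum fun i hi => ?_
        have hi' := Finset.mem_range.1 hi
        have hle : ‖x (φ (i + 1)) - x (φ i)‖ ≤ 2 * ε := by
          have := norm_sub_le (x (φ (i + 1))) (x (φ i))
          linarith [hε _ (hT _ hi'), hε _ (hT _ hi'.le)]
        rw [show r = (r - q) + q by ring, Real.rpow_add_of_nonneg (norm_nonneg _)
          (by linarith) hq.le, sub_add_cancel]
        gcongr
    _ ≤ _ := by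
        rw [← Finset.mul_sum]
        gcongr
        exact h n φ hφ hT

end Variation

/-! ### Young's inequality for Riemann–Stieltjes sums -/

section Young

variable {E F : Type*} [NormedAddCommGroup E] [NormedSpace ℝ E] [NormedAddCommGroup F]
  [NormedSpace ℝ F]

theorem exists_mul_le_of_sum_rpow_le {p q A B : ℝ} (hp : 0 < p) (hq : 0 < q) {α β : ℕ → ℝ}
    (hα : ∀ i, 0 ≤ α i) (hβ : ∀ i, 0 ≤ β i) (n : ℕ)
    (hA : ∑ i ∈ Finset.range (n + 1), α i ^ q ≤ A)
    (hB : ∑ i ∈ Finset.range (n + 1), β i ^ p ≤ B) :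
    ∃ i ≤ n, α i * β i ≤ ((n : ℝ) + 1) ^ (-(1 / p + 1 / q)) * (A ^ (1 / q) * B ^ (1 / p)) := by
  have hA0 : 0 ≤ A := le_trans (Finset.sum_nonneg fun i _ => Real.rpow_nonneg (hα i) _) hA
  have hB0 : 0 ≤ B := le_trans (Finset.sum_nonneg fun i _ => Real.rpow_nonneg (hβ i) _) hB
  by_contra! hcon
  set m := ((n : ℝ) + 1) ^ (-(1 / p + 1 / q)) * (A ^ (1 / q) * B ^ (1 / p)) with hm
  have hm0 : 0 ≤ m := by positivity
  set θ := 1 / p + 1 / q with hθ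
  have hθ0 : 0 < θ := by positivity
  set r := 1 / θ with hr
  have hr0 : 0 < r := by positivity
  have hconj : (q / r).HolderConjugate (p / r) := by
    refine ⟨?_, by positivity, by positivity⟩
    rw [inv_div, inv_div, inv_one, hr, hθ]
    field_simp
    ring
  have hH := Real.inner_le_Lp_mul_Lq_of_nonneg (Finset.range (n + 1)) hconj
    (f := fun i => α i ^ r) (g := fun i => β i ^ r)
    (fun i _ => Real.rpow_nonneg (hα i) _) (fun i _ => Real.rpow_nonneg (hβ i) _)
  have e1 : ∀ i, (α i ^ r) ^ (q / r) = α i ^ q := fun i => by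
    rw [← Real.rpow_mul (hα i)]; congr 1; field_simp
  have e2 : ∀ i, (β i ^ r) ^ (p / r) = β i ^ p := fun i => by
    rw [← Real.rpow_mul (hβ i)]; congr 1; field_simp
  simp only [e1, e2] at hH
  have hlow : ((n : ℝ) + 1) * m ^ r < ∑ i ∈ Finset.range (n + 1), α i ^ r * β i ^ r := by
    have : ∑ i ∈ Finset.range (n + 1), m ^ r < ∑ i ∈ Finset.range (n + 1), α i ^ r * β i ^ r := by
      refine Finset.sum_lt_sum_of_nonempty ⟨0, by simp⟩ fun i hi => ?_
      rw [← Real.mul_rpow (hα i) (hβ i)]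
      exact Real.rpow_lt_rpow hm0 (hcon i (Nat.lt_succ_iff.1 (Finset.mem_range.1 hi))) hr0
    simpa using this
  have hup : (∑ i ∈ Finset.range (n + 1), α i ^ q) ^ (1 / (q / r)) *
      (∑ i ∈ Finset.range (n + 1), β i ^ p) ^ (1 / (p / r)) ≤
      A ^ (1 / (q / r)) * B ^ (1 / (p / r)) := by
    have h1 := Finset.sum_nonneg fun i (_ : i ∈ Finset.range (n + 1)) => Real.rpow_nonneg (hα i) q
    have h2 := Finset.sum_nonneg fun i (_ : i ∈ Finset.range (n + 1)) => Real.rpow_nonneg (hβ i) p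
    gcongr
  have hmr : ((n : ℝ) + 1) * m ^ r = A ^ (1 / (q / r)) * B ^ (1 / (p / r)) := by
    have hn : (0 : ℝ) < (n : ℝ) + 1 := by positivity
    rw [hm, Real.mul_rpow (by positivity) (by positivity),
      Real.mul_rpow (by positivity) (by positivity), ← Real.rpow_mul hn.le,
      ← Real.rpow_mul hA0, ← Real.rpow_mul hB0, show -θ * r = -1 by rw [hr]; field_simp,
      Real.rpow_neg_one, ← mul_assoc, mul_inv_cancel₀ hn.ne', one_mul]
    congr 2 <;> field_simp
  linarith

/-- Removing the point `φ (i + 1)` changes a Riemann–Stieltjes sum by a single product. -/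
theorem rsSum_skip (x : ℝ → E →L[ℝ] F) (z : ℝ → E) (φ : ℕ → ℝ) {n i : ℕ} (hi : i ≤ n) :
    rsSum x z φ (n + 2) = rsSum x z (fun j => φ (if j ≤ i then j else j + 1)) (n + 1) +
      (x (φ (i + 1)) - x (φ i)) (z (φ (i + 2)) - z (φ (i + 1))) := by
  unfold rsSum
  obtain ⟨k, rfl⟩ := Nat.exists_eq_add_of_le hi
  rw [show i + k + 2 = i + (1 + (1 + k)) by ring, show i + k + 1 = i + (1 + k) by ring]
  simp only [Finset.sum_range_add]
  have h1 : ∑ j ∈ Finset.range i, x (φ (if j ≤ i then j else j + 1))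
      (z (φ (if j + 1 ≤ i then j + 1 else j + 1 + 1)) - z (φ (if j ≤ i then j else j + 1))) =
      ∑ j ∈ Finset.range i, x (φ j) (z (φ (j + 1)) - z (φ j)) := by
    refine Finset.sum_congr rfl fun j hj => ?_
    have := Finset.mem_range.1 hj
    rw [if_pos this.le, if_pos (Nat.succ_le_of_lt this)]
  have h2 : ∀ j, ¬ i + (1 + j) ≤ i := fun j => by omega
  have h3 : ∀ j, ¬ i + (1 + j) + 1 ≤ i := fun j => by omega
  rw [h1]
  simp only [Finset.sum_range_one, h2, h3, if_false, add_zero, le_refl, if_true,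
    Nat.not_succ_le_self, map_sub, sub_apply]
  have h4 : ∀ j, i + (1 + (1 + j)) = i + (1 + j) + 1 := fun j => by ring
  simp only [h4]
  abel

theorem norm_rsSum_sub_le {p q A B : ℝ} (hp : 0 < p) (hq : 0 < q) {x : ℝ → E →L[ℝ] F}
    {z : ℝ → E} {S T : Set ℝ} (hx : VarBound q x S A) (hz : VarBound p z T B) (n : ℕ)
    (φ : ℕ → ℝ) (hφ : Monotone φ) (hS : ∀ i ≤ n, φ i ∈ S) (hT : ∀ i ≤ n + 1, φ i ∈ T) :
    ‖rsSum x z φ (n + 1) - x (φ 0) (z (φ (n + 1)) - z (φ 0))‖ ≤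
      (∑ j ∈ Finset.range n, ((j : ℝ) + 1) ^ (-(1 / p + 1 / q))) *
        (A ^ (1 / q) * B ^ (1 / p)) := by
  induction n generalizing φ with
  | zero => simp [rsSum]
  | succ n ih =>
    obtain ⟨i, hi, hle⟩ := exists_mul_le_of_sum_rpow_le hp hq
      (α := fun i => ‖x (φ (i + 1)) - x (φ i)‖) (β := fun i => ‖z (φ (i + 2)) - z (φ (i + 1))‖)
      (fun _ => norm_nonneg _) (fun _ => norm_nonneg _) n (hx (n + 1) φ hφ hS)
      (hz (n + 1) (fun i => φ (i + 1)) (fun i j hij => hφ (by omega))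
        fun i hi => hT _ (by omega))
    rw [rsSum_skip x z φ hi]
    have := ih (fun j => φ (if j ≤ i then j else j + 1))
      (fun j k hjk => hφ (by split_ifs <;> omega))
      (fun j hj => hS _ (by split_ifs <;> omega)) (fun j hj => hT _ (by split_ifs <;> omega))
    simp only [Nat.zero_le, if_true, show ¬ n + 1 ≤ i by omega, if_false] at this
    rw [Finset.sum_range_succ, add_mul, add_sub_right_comm]
    refine (norm_add_le _ _).trans (add_le_add this ?_)
    exact (ContinuousLinearMap.le_opNorm _ _).trans hle

theorem summable_young {θ : ℝ} (hθ : 1 < θ) : Summable fun n : ℕ => ((n : ℝ) + 1) ^ (-θ) := by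
  have := (summable_nat_add_iff 1).2 (Real.summable_nat_rpow.2 (show -θ < -1 by linarith))
  simpa using this

theorem norm_rsSum_sub_le_tsum {p q A B : ℝ} (hp : 0 < p) (hq : 0 < q)
    (hpq : 1 < 1 / p + 1 / q) (hA : 0 ≤ A) (hB : 0 ≤ B) {x : ℝ → E →L[ℝ] F} {z : ℝ → E}
    {S T : Set ℝ} (hx : VarBound q x S A) (hz : VarBound p z T B) (n : ℕ)
    (φ : ℕ → ℝ) (hφ : Monotone φ) (hS : ∀ i ≤ n, φ i ∈ S) (hT : ∀ i ≤ n + 1, φ i ∈ T) :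
    ‖rsSum x z φ (n + 1) - x (φ 0) (z (φ (n + 1)) - z (φ 0))‖ ≤
      (∑' j : ℕ, ((j : ℝ) + 1) ^ (-(1 / p + 1 / q))) * (A ^ (1 / q) * B ^ (1 / p)) := by
  refine (norm_rsSum_sub_le hp hq hx hz n φ hφ hS hT).trans ?_
  gcongr
  exact (summable_young hpq).sum_le_tsum _ fun j _ => by positivity

end Young

/-! ### Càdlàg functions -/

section Cadlag

variable {E G : Type*} [NormedAddCommGroup E] [NormedAddCommGroup G] {f g : ℝ → E}

theorem Cadlag.add (hf : Cadlag f) (hg : Cadlag g) : Cadlag fun u => f u + g u := by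
  refine ⟨fun t => (hf.1 t).add (hg.1 t), fun t => ?_⟩
  obtain ⟨c, hc⟩ := hf.2 t
  obtain ⟨c', hc'⟩ := hg.2 t
  exact ⟨c + c', hc.add hc'⟩

theorem Continuous.comp_cadlag {h : E → G} (hh : Continuous h) (hf : Cadlag f) :
    Cadlag fun u => h (f u) := by
  refine ⟨fun t => hh.continuousAt.comp_continuousWithinAt (hf.1 t), fun t => ?_⟩
  obtain ⟨c, hc⟩ := hf.2 t
  exact ⟨h c, (hh.tendsto c).comp hc⟩

theorem Cadlag.comp_max (hf : Cadlag f) (m : ℝ) : Cadlag fun u => f (max u m) := by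
  constructor
  · intro t
    refine ContinuousWithinAt.comp (t := Ici (max t m)) (hf.1 _) ?_ ?_
    · exact (continuous_id.max continuous_const).continuousWithinAt
    · exact fun u hu => max_le_max_right m hu
  · intro t
    rcases le_or_gt t m with h | h
    · refine ⟨f m, tendsto_const_nhds.congr' ?_⟩
      filter_upwards [self_mem_nhdsWithin] with u hu
      rw [max_eq_right ((mem_Iio.1 hu).le.trans h)]
    · obtain ⟨c, hc⟩ := hf.2 t
      refine ⟨c, hc.congr' ?_⟩
      filter_upwards [mem_nhdsWithin_of_mem_nhds (Ioi_mem_nhds h)] with u hu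
      rw [max_eq_left (mem_Ioi.1 hu).le]

theorem Cadlag.comp_min (hf : Cadlag f) (m : ℝ) : Cadlag fun u => f (min u m) := by
  constructor
  · intro t
    refine ContinuousWithinAt.comp (t := Ici (min t m)) (hf.1 _) ?_ ?_
    · exact (continuous_id.min continuous_const).continuousWithinAt
    · exact fun u hu => min_le_min_right m hu
  · intro t
    rcases le_or_gt t m with h | h
    · obtain ⟨c, hc⟩ := hf.2 t
      refine ⟨c, hc.congr' ?_⟩
      filter_upwards [self_mem_nhdsWithin] with u hu
      rw [min_eq_left ((mem_Iio.1 hu).le.trans h)]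
    · refine ⟨f m, tendsto_const_nhds.congr' ?_⟩
      filter_upwards [mem_nhdsWithin_of_mem_nhds (Ioi_mem_nhds h)] with u hu
      rw [min_eq_right (mem_Ioi.1 hu).le]

/-- A uniform limit of càdlàg functions is càdlàg. -/
theorem cadlag_of_uniform_approx [CompleteSpace E]
    (h : ∀ ε > 0, ∃ g : ℝ → E, Cadlag g ∧ ∀ u, ‖f u - g u‖ ≤ ε) : Cadlag f := by
  constructor
  · intro t
    rw [ContinuousWithinAt, Metric.tendsto_nhds]
    intro ε hε
    obtain ⟨g, hg, hfg⟩ := h (ε / 4) (by linarith)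
    filter_upwards [Metric.tendsto_nhds.1 (hg.1 t) (ε / 4) (by linarith)] with u hu
    rw [dist_eq_norm] at hu ⊢
    calc ‖f u - f t‖ = ‖(f u - g u) + (g u - g t) - (f t - g t)‖ := by congr 1; abel
      _ ≤ ‖f u - g u‖ + ‖g u - g t‖ + ‖f t - g t‖ :=
        (norm_sub_le _ _).trans (add_le_add_left (norm_add_le _ _) _)
      _ < ε := by linarith [hfg u, hfg t]
  · intro t
    refine cauchy_map_iff_exists_tendsto.1 (Metric.cauchy_iff.2 ⟨inferInstance, fun ε hε => ?_⟩)
    obtain ⟨g, hg, hfg⟩ := h (ε / 8) (by linarith)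
    obtain ⟨c, hc⟩ := hg.2 t
    refine ⟨Metric.ball c (ε / 2), ?_, ?_⟩
    · rw [mem_map]
      filter_upwards [Metric.tendsto_nhds.1 hc (ε / 4) (by linarith)] with u hu
      rw [dist_eq_norm] at hu
      rw [mem_preimage, Metric.mem_ball, dist_eq_norm]
      calc ‖f u - c‖ = ‖(f u - g u) + (g u - c)‖ := by congr 1; abel
        _ ≤ ‖f u - g u‖ + ‖g u - c‖ := norm_add_le _ _
        _ < ε / 2 := by linarith [hfg u]
    · intro u hu v hv
      linarith [dist_triangle_right u v c, Metric.mem_ball.1 hu, Metric.mem_ball.1 hv]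

theorem Cadlag.exists_ball_osc_le (hf : Cadlag f) {ε : ℝ} (hε : 0 < ε) (t : ℝ) :
    ∃ r > 0, ∀ u v, |u - t| < r → |v - t| < r → (t ≤ u ∧ t ≤ v ∨ u < t ∧ v < t) →
      ‖f v - f u‖ ≤ ε := by
  obtain ⟨c, hc⟩ := hf.2 t
  obtain ⟨r₁, hr₁, h₁⟩ := Metric.tendsto_nhdsWithin_nhds.1 (hf.1 t) (ε / 2) (by linarith)
  obtain ⟨r₂, hr₂, h₂⟩ := Metric.tendsto_nhdsWithin_nhds.1 hc (ε / 2) (by linarith)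
  refine ⟨min r₁ r₂, lt_min hr₁ hr₂, fun u v hu hv huv => ?_⟩
  rw [← Real.dist_eq, lt_min_iff] at hu hv
  rw [← dist_eq_norm]
  rcases huv with ⟨hu', hv'⟩ | ⟨hu', hv'⟩
  · linarith [dist_triangle_right (f v) (f u) (f t), h₁ hu' hu.1, h₁ hv' hv.1]
  · linarith [h₂ hu' hu.2, h₂ hv' hv.2, dist_triangle_right (f v) (f u) c]

/-- A càdlàg function oscillates little between consecutive points of some finite set. -/
theorem Cadlag.exists_finset_osc_le (hf : Cadlag f) {ε a b : ℝ} (hε : 0 < ε) (hab : a ≤ b) :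
    ∃ D : Finset ℝ, ∀ u v, a ≤ u → u ≤ v → v ≤ b → (∀ s ∈ D, s ≤ v → s ≤ u) →
      ‖f v - f u‖ ≤ ε := by
  choose r hr hosc using fun t => hf.exists_ball_osc_le hε t
  obtain ⟨t, ht0, htm, ⟨m, hm⟩, hcov⟩ := exists_monotone_Icc_subset_open_cover_Icc hab
    (c := fun s : ℝ => {u : Icc a b | |(u : ℝ) - s| < r s})
    (fun s => isOpen_lt (by fun_prop) continuous_const)
    (fun u _ => mem_iUnion.2 ⟨u, by simpa using hr u⟩)
  choose c hc using hcov
  classical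
  refine ⟨(Finset.range m).image (fun n => (t n : ℝ)) ∪ (Finset.range m).image c,
    fun u v hau huv hvb hD => ?_⟩
  have hex : ∃ n, v ≤ t n := ⟨m, by simpa [hm m le_rfl] using hvb⟩
  obtain ⟨N, hN⟩ : ∃ N, N = Nat.find hex := ⟨_, rfl⟩
  have hvN : v ≤ t N := hN ▸ Nat.find_spec hex
  have hNm : N ≤ m := hN ▸ Nat.find_min' hex (by simpa [hm m le_rfl] using hvb)
  rcases N with _ | n
  · have : v = u := le_antisymm (by rw [ht0] at hvN; exact hvN.trans hau) huv
    simpa [this] using hε.le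
  · have htv : (t n : ℝ) < v := not_le.1 (Nat.find_min hex (hN ▸ n.lt_succ_self))
    have hn : n ∈ Finset.range m := Finset.mem_range.2 hNm
    have htu : (t n : ℝ) ≤ u :=
      hD _ (Finset.mem_union_left _ (Finset.mem_image_of_mem (fun n => (t n : ℝ)) hn)) htv.le
    have hcn := hD (c n) (Finset.mem_union_right _ (Finset.mem_image_of_mem _ hn))
    refine hosc (c n) u v
      (hc n (show (⟨u, hau, huv.trans hvb⟩ : Icc a b) ∈ _ from ⟨htu, huv.trans hvN⟩))
      (hc n (show (⟨v, hau.trans huv, hvb⟩ : Icc a b) ∈ _ from ⟨htv.le, hvN⟩)) ?_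
    rcases le_or_gt (c n) v with h | h
    · exact Or.inl ⟨hcn h, h⟩
    · exact Or.inr ⟨huv.trans_lt h, h⟩

end Cadlag

/-! ### Step functions and their integrals -/

section Step

variable {E F : Type*} [NormedAddCommGroup E] [NormedSpace ℝ E] [NormedAddCommGroup F]
  [NormedSpace ℝ F] {x y : ℝ → E →L[ℝ] F} {z : ℝ → E} {a b t : ℝ} {I J : F}

/-- `IsRSInt` for the evaluation pairing, with partitions given by sequences. -/
def HasRSInt (x : ℝ → E →L[ℝ] F) (z : ℝ → E) (a b : ℝ) (I : F) : Prop :=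
  ∀ ε : ℝ, 0 < ε → ∃ δ : ℝ, 0 < δ ∧ ∀ (n : ℕ) (φ : ℕ → ℝ), Monotone φ → φ 0 = a → φ n = b →
    (∀ i < n, φ (i + 1) - φ i ≤ δ) → ‖rsSum x z φ n - I‖ < ε

theorem HasRSInt.isRSInt (h : HasRSInt x z a b I) :
    IsRSInt (fun (A : E →L[ℝ] F) (v : E) => A v) x z a b I := by
  intro ε hε
  obtain ⟨δ, hδ, H⟩ := h ε hε
  refine ⟨δ, hδ, fun n t ht h0 hn hmesh => ?_⟩
  obtain ⟨φ, hφ, h0', hn', hc, hs⟩ := exists_seq_of_fin ht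
  have := H n φ hφ (h0'.trans h0) (hn'.trans hn) fun i hi => by
    have := hmesh ⟨i, hi⟩
    rwa [← hc, ← hs] at this
  simpa [rsSum, Finset.sum_range, hc, hs] using this

theorem rsSum_add (x y : ℝ → E →L[ℝ] F) (z : ℝ → E) (φ : ℕ → ℝ) (n : ℕ) :
    rsSum (fun u => x u + y u) z φ n = rsSum x z φ n + rsSum y z φ n := by
  simp [rsSum, Finset.sum_add_distrib]

theorem rsSum_sub (x y : ℝ → E →L[ℝ] F) (z : ℝ → E) (φ : ℕ → ℝ) (n : ℕ) :
    rsSum (fun u => x u - y u) z φ n = rsSum x z φ n - rsSum y z φ n := by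
  rw [eq_sub_iff_add_eq, ← rsSum_add]
  simp

theorem rsSum_const (c : E →L[ℝ] F) (z : ℝ → E) (φ : ℕ → ℝ) (n : ℕ) :
    rsSum (fun _ => c) z φ n = c (z (φ n) - z (φ 0)) := by
  rw [rsSum, ← map_sum, Finset.sum_range_sub (fun i => z (φ i))]

theorem hasRSInt_const (c : E →L[ℝ] F) (z : ℝ → E) (a b : ℝ) :
    HasRSInt (fun _ => c) z a b (c (z b - z a)) := by
  refine fun ε hε => ⟨1, one_pos, fun n φ _ h0 hn _ => ?_⟩
  rwa [rsSum_const, h0, hn, sub_self, norm_zero]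

theorem HasRSInt.add (hx : HasRSInt x z a b I) (hy : HasRSInt y z a b J) :
    HasRSInt (fun u => x u + y u) z a b (I + J) := by
  intro ε hε
  obtain ⟨δ₁, hδ₁, H₁⟩ := hx (ε / 2) (by linarith)
  obtain ⟨δ₂, hδ₂, H₂⟩ := hy (ε / 2) (by linarith)
  refine ⟨min δ₁ δ₂, lt_min hδ₁ hδ₂, fun n φ hφ h0 hn hmesh => ?_⟩
  have h₁ := H₁ n φ hφ h0 hn fun i hi => (hmesh i hi).trans (min_le_left _ _)
  have h₂ := H₂ n φ hφ h0 hn fun i hi => (hmesh i hi).trans (min_le_right _ _)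
  rw [rsSum_add, add_sub_add_comm]
  linarith [norm_add_le (rsSum x z φ n - I) (rsSum y z φ n - J)]

open Classical in
theorem rsSum_step (c : E →L[ℝ] F) (z : ℝ → E) {m δ : ℝ} (hδ : 0 ≤ δ) {φ : ℕ → ℝ}
    (hφ : Monotone φ) (h0 : φ 0 ≤ m) (n : ℕ) (hmesh : ∀ i < n, φ (i + 1) - φ i ≤ δ) :
    (φ n < m ∧ rsSum (fun u => if m ≤ u then c else 0) z φ n = 0) ∨
      (m ≤ φ n ∧ ∃ v ∈ Icc m (m + δ),
        rsSum (fun u => if m ≤ u then c else 0) z φ n = c (z (φ n) - z v)) := by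
  induction n with
  | zero =>
    rcases h0.lt_or_eq with h | h
    · exact Or.inl ⟨h, by simp [rsSum]⟩
    · exact Or.inr ⟨h.ge, m, ⟨le_rfl, by linarith⟩, by simp [rsSum, h]⟩
  | succ n ih =>
    have hstep : rsSum (fun u => if m ≤ u then c else 0) z φ (n + 1) =
        rsSum (fun u => if m ≤ u then c else 0) z φ n +
          (if m ≤ φ n then c else 0) (z (φ (n + 1)) - z (φ n)) := by
      simp only [rsSum, Finset.sum_range_succ]
    have hlast := hmesh n n.lt_succ_self
    rw [hstep]
    rcases ih fun i hi => hmesh i (hi.trans n.lt_succ_self) with ⟨h, hs⟩ | ⟨h, v, hv, hs⟩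
    · rw [hs, if_neg h.not_ge]
      rcases lt_or_ge (φ (n + 1)) m with h' | h'
      · exact Or.inl ⟨h', by simp⟩
      · exact Or.inr ⟨h', φ (n + 1), ⟨h', by linarith⟩, by simp⟩
    · rw [hs, if_pos h, ← map_add]
      exact Or.inr ⟨h.trans (hφ n.le_succ), v, hv, by congr 1; abel⟩

open Classical in
theorem hasRSInt_step (c : E →L[ℝ] F) (hz : Cadlag z) {m : ℝ} (ham : a ≤ m) (t : ℝ) :
    HasRSInt (fun u => if m ≤ u then c else 0) z a t (c (z (max t m) - z m)) := by
  intro ε hε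
  have hη : 0 < ε / (‖c‖ + 1) := by positivity
  obtain ⟨δ, hδ, H⟩ := Metric.tendsto_nhdsWithin_nhds.1 (hz.1 m) _ hη
  refine ⟨δ / 2, by linarith, fun n φ hφ h0 hn hmesh => ?_⟩
  rcases rsSum_step c z (half_pos hδ).le hφ (h0 ▸ ham) n hmesh with ⟨h, hs⟩ | ⟨h, v, hv, hs⟩
  · rw [hs, max_eq_right (hn ▸ h.le)]
    simpa using hε
  · rw [hs, hn, max_eq_left (hn ▸ h), ← map_sub, sub_sub_sub_cancel_left]
    have hd := H hv.1 (by rw [Real.dist_eq, abs_of_nonneg] <;> linarith [hv.1, hv.2])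
    rw [dist_eq_norm, norm_sub_rev, lt_div_iff₀ (by positivity)] at hd
    nlinarith [c.le_opNorm (z m - z v), norm_nonneg (z m - z v)]

/-- Existence of the integral over all `[a, t]`, as a càdlàg function of `t`. -/
def CadlagIntegrable (x : ℝ → E →L[ℝ] F) (z : ℝ → E) (a : ℝ) : Prop :=
  ∃ J : ℝ → F, Cadlag J ∧ ∀ t, HasRSInt x z a t (J t)

open Classical in
theorem exists_monotone_step (x : ℝ → E →L[ℝ] F) (hz : Cadlag z) (a : ℝ) (D : Finset ℝ)
    (hD : ∀ s ∈ D, a ≤ s) :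
    ∃ τ : ℝ → ℝ, Monotone τ ∧ (∀ u, a ≤ τ u ∧ τ u ≤ max a u) ∧
      (∀ u, ∀ s ∈ D, s ≤ u → s ≤ τ u) ∧
      (∀ u v, (∀ s ∈ D, s ≤ u) → (∀ s ∈ D, s ≤ v) → τ u = τ v) ∧
      CadlagIntegrable (fun u => x (τ u)) z a := by
  induction D using Finset.induction_on_max with
  | empty =>
    refine ⟨fun _ => a, monotone_const, fun u => ⟨le_rfl, le_max_left _ _⟩, by simp, by simp,
      fun t => x a (z t - z a), ?_, fun t => hasRSInt_const _ _ _ _⟩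
    exact ((x a).continuous.comp (continuous_sub_right (z a))).comp_cadlag hz
  | insert m D hm ih =>
    obtain ⟨τ, hτ, hbd, hle, hconst, J, hJ, hint⟩ :=
      ih fun s hs => hD s (Finset.mem_insert_of_mem hs)
    have ham : a ≤ m := hD m (Finset.mem_insert_self _ _)
    have hτm : ∀ u, m ≤ u → τ u = τ m := fun u hu =>
      hconst _ _ (fun s hs => (hm s hs).le.trans hu) fun s hs => (hm s hs).le
    refine ⟨fun u => if m ≤ u then m else τ u, fun u v huv => ?_, fun u => ?_, fun u s hs hsu => ?_,
      fun u v hu hv => ?_, fun t => J t + (x m - x (τ m)) (z (max t m) - z m), ?_, fun t => ?_⟩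
    · dsimp only
      split_ifs with h₁ h₂ h₂
      · exact le_rfl
      · exact absurd (h₁.trans huv) h₂
      · exact (hbd u).2.trans (max_le ham (not_le.1 h₁).le)
      · exact hτ huv
    · dsimp only
      split_ifs with h
      · exact ⟨ham, h.trans (le_max_right _ _)⟩
      · exact hbd u
    · dsimp only
      rcases Finset.mem_insert.1 hs with rfl | hs
      · rw [if_pos hsu]
      · split_ifs with h
        · exact (hm s hs).le
        · exact hle u s hs hsu
    · dsimp only
      rw [if_pos (hu m (Finset.mem_insert_self _ _)), if_pos (hv m (Finset.mem_insert_self _ _))]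
    · exact hJ.add (((x m - x (τ m)).continuous.comp (continuous_sub_right (z m))).comp_cadlag
        (hz.comp_max m))
    · convert (hint t).add (hasRSInt_step (x m - x (τ m)) hz ham t) using 2 with u
      by_cases h : m ≤ u
      · simp [h, hτm u h]
      · simp [h]

end Step

/-! ### Existence and variation of the integral -/

theorem VarBound.norm_sub_le {E : Type*} [NormedAddCommGroup E] {z : ℝ → E} {T : Set ℝ}
    {p C u v : ℝ} (hp : 0 < p) (h : VarBound p z T C) (hu : u ∈ T) (hv : v ∈ T) (huv : u ≤ v) :
    ‖z v - z u‖ ≤ C ^ (1 / p) := by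
  have := h 1 (fun i => if i = 0 then u else v)
    (fun i j hij => by dsimp only; split_ifs <;> first | omega | exact le_rfl)
    (fun i _ => by split_ifs <;> assumption)
  simp only [Finset.sum_range_one, zero_add, one_ne_zero, if_false, if_true] at this
  calc ‖z v - z u‖ = (‖z v - z u‖ ^ p) ^ (1 / p) := by
        rw [one_div, Real.rpow_rpow_inv (norm_nonneg _) hp.ne']
    _ ≤ C ^ (1 / p) := by gcongr

section Integral

variable {E F : Type*} [NormedAddCommGroup E] [NormedSpace ℝ E] [NormedAddCommGroup F]
  [NormedSpace ℝ F] {x y : ℝ → E →L[ℝ] F} {z : ℝ → E} {a b p q : ℝ}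

/-- The `i`-th point of the uniform partition of `[a, b]` into `n + 1` intervals. -/
def gridPoint (a b : ℝ) (n i : ℕ) : ℝ := a + (b - a) * (i / ((n : ℝ) + 1))

theorem gridPoint_zero (n : ℕ) : gridPoint a b n 0 = a := by simp [gridPoint]

theorem gridPoint_last (n : ℕ) : gridPoint a b n (n + 1) = b := by
  have : (n : ℝ) + 1 ≠ 0 := by positivity
  simp [gridPoint, div_self this]

theorem gridPoint_succ_sub (n i : ℕ) :
    gridPoint a b n (i + 1) - gridPoint a b n i = (b - a) * (1 / ((n : ℝ) + 1)) := by
  rw [gridPoint, gridPoint]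
  push_cast
  ring

theorem gridPoint_monotone (hab : a ≤ b) (n : ℕ) : Monotone (gridPoint a b n) := by
  refine monotone_nat_of_le_succ fun i => ?_
  rw [← sub_nonneg, gridPoint_succ_sub]
  have := sub_nonneg.2 hab
  positivity

theorem gridPoint_lt (hab : a < b) {n i : ℕ} (hi : i ≤ n) : gridPoint a b n i < b := by
  refine (gridPoint_monotone hab.le n hi).trans_lt ?_
  have h := gridPoint_succ_sub (a := a) (b := b) n n
  have : 0 < (b - a) * (1 / ((n : ℝ) + 1)) := mul_pos (sub_pos.2 hab) (by positivity)
  rw [gridPoint_last] at h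
  linarith

theorem HasRSInt.tendsto_grid {t : ℝ} {I : F} (hab : a ≤ b) (ht : t ∈ Icc a b)
    (h : HasRSInt x z a t I) :
    Tendsto (fun n => rsSum x z (fun i => min (gridPoint a b n i) t) (n + 1)) atTop (nhds I) := by
  rw [Metric.tendsto_nhds]
  intro ε hε
  obtain ⟨δ, hδ, H⟩ := h ε hε
  have hlim : Tendsto (fun n : ℕ => (b - a) * (1 / ((n : ℝ) + 1))) atTop (nhds 0) := by
    simpa using tendsto_one_div_add_atTop_nhds_zero_nat.const_mul (b - a)
  filter_upwards [hlim.eventually_lt_const hδ] with n hn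
  rw [dist_eq_norm]
  refine H _ _ ((gridPoint_monotone hab n).min monotone_const) ?_ ?_ fun i _ => ?_
  · rw [gridPoint_zero, min_eq_left ht.1]
  · rw [gridPoint_last, min_eq_right ht.2]
  · have h1 := gridPoint_succ_sub (a := a) (b := b) n i
    have h2 := gridPoint_monotone hab n i.le_succ
    rcases le_total (gridPoint a b n i) t with h3 | h3
    · rw [min_eq_left h3]
      linarith [min_le_left (gridPoint a b n (i + 1)) t]
    · rw [min_eq_right h3, min_eq_right (h3.trans h2), sub_self]
      exact hδ.le

theorem HasRSInt.norm_sub_le {t η : ℝ} {I J : F} (hat : a ≤ t) (hx : HasRSInt x z a t I)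
    (hy : HasRSInt y z a t J)
    (h : ∀ (n : ℕ) (φ : ℕ → ℝ), Monotone φ → φ 0 = a → φ n = t →
      ‖rsSum x z φ n - rsSum y z φ n‖ ≤ η) : ‖I - J‖ ≤ η := by
  refine le_of_tendsto ((hx.tendsto_grid hat ⟨hat, le_rfl⟩).sub
    (hy.tendsto_grid hat ⟨hat, le_rfl⟩)).norm (Eventually.of_forall fun n => ?_)
  refine h _ _ ((gridPoint_monotone hat n).min monotone_const) ?_ ?_
  · rw [gridPoint_zero, min_eq_left hat]
  · rw [gridPoint_last, min_self]

theorem exists_hasRSInt_of_approx [CompleteSpace F] {t : ℝ} (hat : a ≤ t)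
    (h : ∀ η > 0, ∃ (y : ℝ → E →L[ℝ] F) (J : F), HasRSInt y z a t J ∧
      ∀ (n : ℕ) (φ : ℕ → ℝ), Monotone φ → φ 0 = a → φ n = t →
        ‖rsSum x z φ n - rsSum y z φ n‖ ≤ η) :
    ∃ I, HasRSInt x z a t I := by
  have hgrid : ∀ n, Monotone (fun i => min (gridPoint a t n i) t) ∧
      min (gridPoint a t n 0) t = a ∧ min (gridPoint a t n (n + 1)) t = t := fun n =>
    ⟨(gridPoint_monotone hat n).min monotone_const, by rw [gridPoint_zero, min_eq_left hat],
      by rw [gridPoint_last, min_self]⟩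
  have hcauchy : CauchySeq fun n => rsSum x z (fun i => min (gridPoint a t n i) t) (n + 1) := by
    rw [Metric.cauchySeq_iff']
    intro ε hε
    obtain ⟨y, J, hy, hxy⟩ := h (ε / 4) (by linarith)
    obtain ⟨N, hN⟩ := eventually_atTop.1 <|
      Metric.tendsto_nhds.1 (hy.tendsto_grid hat ⟨hat, le_rfl⟩) (ε / 4) (by linarith)
    have hclose : ∀ n ≥ N,
        dist (rsSum x z (fun i => min (gridPoint a t n i) t) (n + 1)) J < ε / 2 := by
      intro n hn
      have h1 := hxy (n + 1) _ (hgrid n).1 (hgrid n).2.1 (hgrid n).2.2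
      rw [← dist_eq_norm] at h1
      linarith [hN n hn, dist_triangle (rsSum x z (fun i => min (gridPoint a t n i) t) (n + 1))
        (rsSum y z (fun i => min (gridPoint a t n i) t) (n + 1)) J]
    refine ⟨N, fun n hn => (dist_triangle_right _ _ J).trans_lt ?_⟩
    linarith [hclose n hn, hclose N le_rfl]
  obtain ⟨I, hI⟩ := cauchySeq_tendsto_of_complete hcauchy
  refine ⟨I, fun ε hε => ?_⟩
  obtain ⟨y, J, hy, hxy⟩ := h (ε / 4) (by linarith)
  have hIJ : ‖I - J‖ ≤ ε / 4 :=
    le_of_tendsto (hI.sub (hy.tendsto_grid hat ⟨hat, le_rfl⟩)).norm <|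
      Eventually.of_forall fun n => hxy _ _ (hgrid n).1 (hgrid n).2.1 (hgrid n).2.2
  obtain ⟨δ, hδ, H⟩ := hy (ε / 4) (by linarith)
  refine ⟨δ, hδ, fun n φ hφ h0 hn hmesh => ?_⟩
  have h1 := hxy n φ hφ h0 hn
  have h2 := H n φ hφ h0 hn hmesh
  rw [← dist_eq_norm] at *
  linarith [dist_triangle (rsSum x z φ n) (rsSum y z φ n) I,
    dist_triangle_right (rsSum y z φ n) I J]

theorem exists_gt_one_lt_one_div_add (hp : 1 ≤ p) (hpq : 1 < 1 / p + 1 / q) :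
    ∃ r, q < r ∧ 0 < r ∧ 1 < 1 / p + 1 / r := by
  have hp1 : 1 / p ≤ 1 := by rw [div_le_one (by linarith)]; exact hp
  obtain ⟨s, hs1, hs2⟩ := exists_between (show 1 - 1 / p < 1 / q by linarith)
  have hs0 : 0 < s := by linarith
  have hq0 : 0 < q := one_div_pos.1 (hs0.trans hs2)
  refine ⟨1 / s, ?_, by positivity, by rw [one_div_one_div]; linarith⟩
  rwa [lt_one_div hq0 hs0]

/-- A càdlàg integrand of finite `q`-variation can be replaced by one with a known integral, at
an arbitrarily small cost which is uniform over all partitions. -/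
theorem exists_cadlagIntegrable_approx (hp : 1 ≤ p) (hq : 1 ≤ q) (hpq : 1 < 1 / p + 1 / q)
    (hab : a ≤ b) (hx : Cadlag x) (hz : Cadlag z) (hxv : HasFinVar q x a b)
    (hzv : HasFinVar p z a b) {η : ℝ} (hη : 0 < η) :
    ∃ y : ℝ → E →L[ℝ] F, CadlagIntegrable y z a ∧ ∀ t ∈ Icc a b, ∀ (n : ℕ) (φ : ℕ → ℝ),
      Monotone φ → φ 0 = a → φ n = t → ‖rsSum x z φ n - rsSum y z φ n‖ ≤ η := by
  have hp0 : 0 < p := by linarith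
  have hq0 : 0 < q := by linarith
  obtain ⟨r, hqr, hr0, hpr⟩ := exists_gt_one_lt_one_div_add hp hpq
  set Z := ∑' j : ℕ, ((j : ℝ) + 1) ^ (-(1 / p + 1 / r))
  set V := vpvar q x a b
  have hV : 0 ≤ V := vpvar_nonneg
  set err : ℝ → ℝ := fun ε =>
    Z * (((2 * ε) ^ (r - q) * (2 ^ q * (V + V))) ^ (1 / r) * vpvar p z a b ^ (1 / p)) with herr
  have hcont : Tendsto err (nhds 0) (nhds 0) := by
    have hc : Continuous err := by
      refine continuous_const.mul (Continuous.mul ?_ continuous_const)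
      refine Continuous.rpow_const (Continuous.mul ?_ continuous_const)
        fun _ => Or.inr (by positivity)
      exact Continuous.rpow_const (by fun_prop) fun _ => Or.inr (by linarith)
    have h0 : err 0 = 0 := by
      simp only [herr]
      rw [mul_zero, Real.zero_rpow (sub_pos.2 hqr).ne', zero_mul,
        Real.zero_rpow (by positivity), zero_mul, mul_zero]
    simpa [h0] using hc.tendsto 0
  obtain ⟨ε, hεη, hε⟩ := (((hcont.eventually_lt_const hη).filter_mono
    (nhdsWithin_le_nhds (s := Ioi 0))).and self_mem_nhdsWithin).exists
  classical
  obtain ⟨D, hD⟩ := hx.exists_finset_osc_le hε hab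
  obtain ⟨τ, hτ, hbd, hle, -, hint⟩ := exists_monotone_step x hz a (D.filter (a ≤ ·))
    fun s hs => (Finset.mem_filter.1 hs).2
  have hτu : ∀ u, a ≤ u → τ u ≤ u := fun u hu => (hbd u).2.trans (max_le hu le_rfl)
  refine ⟨_, hint, fun t ht n φ hφ h0 hn => ?_⟩
  rw [← rsSum_sub]
  have hsmall : ∀ u ∈ Icc a b, ‖x u - x (τ u)‖ ≤ ε := fun u hu =>
    hD _ _ (hbd u).1 (hτu u hu.1) hu.2 fun s hs hsu => by
      rcases le_or_gt a s with h | h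
      · exact hle u s (Finset.mem_filter.2 ⟨hs, h⟩) hsu
      · exact h.le.trans (hbd u).1
  have hvar := (hxv.varBound.sub hq0.le (hxv.varBound.comp (S := Icc a b) hτ
    fun u hu => ⟨(hbd u).1, (hτu u hu.1).trans hu.2⟩)).of_exponent_lt hq0 hqr hsmall
  have hmem : ∀ i ≤ n, φ i ∈ Icc a b := fun i hi =>
    ⟨h0 ▸ hφ i.zero_le, (hφ hi).trans (hn ▸ ht.2)⟩
  rcases n with _ | n
  · simpa [rsSum] using hη.le
  · have hyoung := norm_rsSum_sub_le_tsum hp0 hr0 hpr (by positivity) vpvar_nonneg hvar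
      hzv.varBound n φ hφ (fun i hi => hmem i (by omega)) hmem
    have hτa : τ a = a := le_antisymm (hτu a le_rfl) (hbd a).1
    simp only [h0, hτa, sub_self, zero_apply, sub_zero] at hyoung
    exact hyoung.trans hεη.le

theorem exists_cadlag_hasRSInt [CompleteSpace F] (hp : 1 ≤ p) (hq : 1 ≤ q)
    (hpq : 1 < 1 / p + 1 / q) (hab : a ≤ b) (hx : Cadlag x) (hz : Cadlag z)
    (hxv : HasFinVar q x a b) (hzv : HasFinVar p z a b) :
    ∃ I : ℝ → F, Cadlag I ∧ ∀ t ∈ Icc a b, HasRSInt x z a t (I t) := by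
  have happrox : ∀ η > 0, ∃ y : ℝ → E →L[ℝ] F, CadlagIntegrable y z a ∧
      ∀ t ∈ Icc a b, ∀ (n : ℕ) (φ : ℕ → ℝ), Monotone φ → φ 0 = a → φ n = t →
        ‖rsSum x z φ n - rsSum y z φ n‖ ≤ η := fun η hη =>
    exists_cadlagIntegrable_approx hp hq hpq hab hx hz hxv hzv hη
  have hex : ∀ t ∈ Icc a b, ∃ I, HasRSInt x z a t I := fun t ht =>
    exists_hasRSInt_of_approx ht.1 fun η hη => by
      obtain ⟨y, ⟨J, -, hJ⟩, hy⟩ := happrox η hη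
      exact ⟨y, J t, hJ t, hy t ht⟩
  have hclamp : ∀ u, max (min u b) a ∈ Icc a b := fun u =>
    ⟨le_max_right _ _, max_le (min_le_right _ _) hab⟩
  choose I hI using fun u => hex _ (hclamp u)
  refine ⟨I, cadlag_of_uniform_approx fun η hη => ?_, fun t ht => ?_⟩
  · obtain ⟨y, ⟨J, hJ, hJint⟩, hy⟩ := happrox η hη
    exact ⟨fun u => J (max (min u b) a), (hJ.comp_max a).comp_min b, fun u =>
      (hI u).norm_sub_le (hclamp u).1 (hJint _) (hy _ (hclamp u))⟩
  · have := hI t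
    rwa [min_eq_left ht.2, max_eq_left ht.1] at this

theorem rsSum_min (x : ℝ → E →L[ℝ] F) (z : ℝ → E) {φ : ℕ → ℝ} (hφ : Monotone φ) (t : ℝ)
    (n : ℕ) : rsSum x z (fun i => min (φ i) t) n = rsSum x (fun u => z (min u t)) φ n := by
  refine Finset.sum_congr rfl fun i _ => ?_
  dsimp only
  rcases le_total (φ i) t with h | h
  · rw [min_eq_left h]
  · rw [min_eq_right h, min_eq_right (h.trans (hφ i.le_succ)), sub_self, map_zero, map_zero]

/-- The Young–Love estimate for the increments of the integral. -/
theorem HasRSInt.norm_increment_le {s t : ℝ} {I J : F} (hp : 1 ≤ p) (hq : 1 ≤ q)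
    (hpq : 1 < 1 / p + 1 / q) (hxv : HasFinVar q x a b) (hzv : HasFinVar p z a b)
    (has : a ≤ s) (hst : s < t) (htb : t ≤ b) (hI : HasRSInt x z a s I)
    (hJ : HasRSInt x z a t J) :
    ‖J - I‖ ≤ (∑' n : ℕ, ((n : ℝ) + 1) ^ (-(1 / p + 1 / q))) *
      (vpvarIco q x a b ^ (1 / q) + ‖x a‖) * vpvar p z s t ^ (1 / p) := by
  have hp0 : 0 < p := by linarith
  have hq0 : 0 < q := by linarith
  have hab : a < b := (has.trans_lt hst).trans_le htb
  set Z := ∑' n : ℕ, ((n : ℝ) + 1) ^ (-(1 / p + 1 / q)) with hZ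
  have hZ1 : 1 ≤ Z := by
    have := (summable_young hpq).le_tsum 0 fun j _ => by positivity
    simpa only [Nat.cast_zero, zero_add, Real.one_rpow] using this
  refine le_of_tendsto ((hJ.tendsto_grid hab.le ⟨has.trans hst.le, htb⟩).sub
    (hI.tendsto_grid hab.le ⟨has, hst.le.trans htb⟩)).norm (Eventually.of_forall fun n => ?_)
  have hmono := gridPoint_monotone hab.le n
  set w : ℝ → E := fun u => z (max (min u t) s) with hw
  have hsum : rsSum x z (fun i => min (gridPoint a b n i) t) (n + 1) -
      rsSum x z (fun i => min (gridPoint a b n i) s) (n + 1) =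
      rsSum x w (gridPoint a b n) (n + 1) := by
    have hzw : ∀ u, w u = z (min u t) - z (min u s) + z s := fun u => by
      rcases le_total u s with h | h
      · simp [hw, h, h.trans hst.le]
      · simp [hw, h, hst.le]
    rw [rsSum_min x z hmono, rsSum_min x z hmono, rsSum, rsSum, rsSum, ← Finset.sum_sub_distrib]
    refine Finset.sum_congr rfl fun i _ => ?_
    rw [← map_sub, hzw, hzw]
    congr 1
    abel
  have hwv : VarBound p w (Icc a b) (vpvar p z s t) :=
    (hzv.mono has htb).varBound.comp ((monotone_id.min monotone_const).max monotone_const)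
      fun u _ => ⟨le_max_right _ _, max_le (min_le_right _ _) hst.le⟩
  have hmem : ∀ i, i ≤ n + 1 → gridPoint a b n i ∈ Icc a b := fun i hi =>
    ⟨(gridPoint_zero n).ge.trans (hmono i.zero_le), (hmono hi).trans (gridPoint_last n).le⟩
  have hyoung := norm_rsSum_sub_le_tsum hp0 hq0 hpq vpvarIco_nonneg vpvar_nonneg
    hxv.varBound_Ico hwv n _ hmono
    (fun i hi => ⟨(hmem i (by omega)).1, gridPoint_lt hab hi⟩) hmem
  rw [gridPoint_zero, gridPoint_last, ← hZ] at hyoung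
  have hab' := hwv.norm_sub_le hp0 ⟨le_rfl, hab.le⟩ ⟨hab.le, le_rfl⟩ hab.le
  set Vz := vpvar p z s t ^ (1 / p) with hVz
  have hVz0 : 0 ≤ Vz := Real.rpow_nonneg vpvar_nonneg _
  rw [hsum]
  calc ‖rsSum x w (gridPoint a b n) (n + 1)‖
      ≤ ‖rsSum x w (gridPoint a b n) (n + 1) - x a (w b - w a)‖ + ‖x a (w b - w a)‖ :=
        norm_le_norm_sub_add _ _
    _ ≤ Z * (vpvarIco q x a b ^ (1 / q) * Vz) + Z * (‖x a‖ * Vz) := by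
        refine add_le_add hyoung (((x a).le_opNorm _).trans ?_)
        calc ‖x a‖ * ‖w b - w a‖ ≤ 1 * (‖x a‖ * Vz) := by rw [one_mul]; gcongr
          _ ≤ Z * (‖x a‖ * Vz) := by gcongr
    _ = _ := by ring

end Integral

/-- Increments dominated by the `p`-variation of `z` give the same bound on the `p`-variation. -/
theorem Vp_le_of_norm_increment_le {E F : Type*} [NormedAddCommGroup E] [NormedAddCommGroup F]
    {z : ℝ → E} {I : ℝ → F} {a b p K : ℝ} (hp : 0 < p) (hab : a ≤ b) (hK : 0 ≤ K)
    (hzv : HasFinVar p z a b)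
    (h : ∀ s t, a ≤ s → s ≤ t → t ≤ b → ‖I t - I s‖ ≤ K * vpvar p z s t ^ (1 / p)) :
    Vp p I a b ≤ K * Vp p z a b := by
  have hle : vpvar p I a b ≤ K ^ p * vpvar p z a b := by
    refine csSup_le (varSums_nonempty hab) fun v hv => ?_
    obtain ⟨n, φ, hφ, h0, hn, rfl⟩ := exists_seq_of_mem_varSums hv
    calc ∑ i ∈ Finset.range n, ‖I (φ (i + 1)) - I (φ i)‖ ^ p
        ≤ ∑ i ∈ Finset.range n, K ^ p * vpvar p z (φ i) (φ (i + 1)) := by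
          refine Finset.sum_le_sum fun i hi => ?_
          have hi' := Finset.mem_range.1 hi
          calc ‖I (φ (i + 1)) - I (φ i)‖ ^ p
              ≤ (K * vpvar p z (φ i) (φ (i + 1)) ^ (1 / p)) ^ p := by
                gcongr
                exact h _ _ (h0 ▸ hφ i.zero_le) (hφ i.le_succ) (hn ▸ hφ hi')
            _ = _ := by
                rw [Real.mul_rpow hK (Real.rpow_nonneg vpvar_nonneg _), one_div,
                  Real.rpow_inv_rpow vpvar_nonneg hp.ne']
      _ ≤ K ^ p * vpvar p z a b := by
          rw [← Finset.mul_sum]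
          gcongr
          simpa [hn] using sum_vpvar_le hzv hφ h0 n hn.le
  calc Vp p I a b ≤ (K ^ p * vpvar p z a b) ^ (1 / p) := by
        have := vpvar_nonneg (p := p) (x := I) (a := a) (b := b)
        rw [Vp]
        gcongr
    _ = K * Vp p z a b := by
        rw [Real.mul_rpow (by positivity) vpvar_nonneg, one_div, Real.rpow_rpow_inv hK hp.ne', Vp,
          one_div]

theorem young_love_estimate (d : ℕ) (p q a b : ℝ) (hp : 1 ≤ p) (hq : 1 ≤ q)
    (hpq : 1 < 1 / p + 1 / q) (hab : a ≤ b)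
    (x : ℝ → (Eu d →L[ℝ] Eu d)) (z : ℝ → Eu d) (hx : Cadlag x) (hz : Cadlag z)
    (hxv : HasFinVar q x a b) (hzv : HasFinVar p z a b) :
    ∃ I : ℝ → Eu d, Cadlag I ∧ I a = 0 ∧
      (∀ t ∈ Icc a b,
        IsRSInt (fun (A : Eu d →L[ℝ] Eu d) (v : Eu d) => A v) x z a t (I t)) ∧
      Vp p I a b ≤
        (∑' n : ℕ, ((n : ℝ) + 1) ^ (-(1 / p + 1 / q))) *
          (vpvarIco q x a b ^ (1 / q) + ‖x a‖) * Vp p z a b := by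
  obtain ⟨I, hI, hint⟩ := exists_cadlag_hasRSInt hp hq hpq hab hx hz hxv hzv
  refine ⟨I, hI, ?_, fun t ht => (hint t ht).isRSInt, ?_⟩
  · refine norm_le_zero_iff.1 (le_of_forall_pos_le_add fun ε hε => ?_)
    obtain ⟨δ, -, H⟩ := hint a ⟨le_rfl, hab⟩ ε hε
    have := H 0 (fun _ => a) monotone_const rfl rfl (by simp)
    simpa [rsSum] using this.le
  · have hK : 0 ≤ (∑' n : ℕ, ((n : ℝ) + 1) ^ (-(1 / p + 1 / q))) *
        (vpvarIco q x a b ^ (1 / q) + ‖x a‖) :=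
      mul_nonneg (tsum_nonneg fun n => by positivity)
        (add_nonneg (Real.rpow_nonneg vpvarIco_nonneg _) (norm_nonneg _))
    refine Vp_le_of_norm_increment_le (by linarith) hab hK hzv fun s t has hst htb => ?_
    rcases hst.eq_or_lt with rfl | hst
    · rw [sub_self, norm_zero]
      exact mul_nonneg hK (Real.rpow_nonneg vpvar_nonneg _)
    · exact (hint s ⟨has, hst.le.trans htb⟩).norm_increment_le hp hq hpq hxv hzv has hst htb
        (hint t ⟨has.trans hst.le, htb⟩)
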